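/- Let A be a finite set, u : A → [0,∞), γ ∈ (0,1]. Define V_γ* = max_{x∈Δ(A)} Σ_a x_a(1 − γ x_a)u(a), and for infinite histories a define V̲_γ(a) = liminf_{T→∞} U^T_γ(a) and V̲_γ = sup over all infinite histories of V̲_γ(a). Then V̲_γ = V_γ*. In particular, for every infinite history a, liminf_{T→∞} U^T_γ(a) ≤ max_{x∈Δ(A)} Σ_a x_a(1 − γ x_a)u(a). -/

import Mathlib

open Finset Filter

/-- Empirical frequency of action `b` in the first `t` periods of history `a`. -/
noncomputable def freq {A : Type*} [DecidableEq A] (a : ℕ → A) (b : A) (t : ℕ) : ℝ :=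
  if t = 0 then 0 else (∑ s ∈ Finset.Icc 1 t, if a s = b then (1 : ℝ) else 0) / t

/-- Average fatigued payoff of history `a` over the first `T` periods. -/
noncomputable def avgU {A : Type*} [DecidableEq A] (u : A → ℝ) (γ : ℝ) (a : ℕ → A)
    (T : ℕ) : ℝ :=
  (∑ t ∈ Finset.Icc 1 T, (1 - γ * freq a (a t) (t - 1)) * u (a t)) / T

open scoped Topology

section Frequencies

variable {A : Type*} [DecidableEq A]

lemma freq_zero (a : ℕ → A) (b : A) : freq a b 0 = 0 := by simp [freq]

lemma mul_freq (a : ℕ → A) (b : A) (t : ℕ) :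
    (t : ℝ) * freq a b t = ∑ s ∈ Finset.Icc 1 t, if a s = b then (1 : ℝ) else 0 := by
  rcases Nat.eq_zero_or_pos t with rfl | ht
  · simp
  · have : (t : ℝ) ≠ 0 := by positivity
    rw [freq, if_neg ht.ne']
    field_simp

lemma mul_freq_succ (a : ℕ → A) (b : A) (t : ℕ) :
    ((t : ℝ) + 1) * freq a b (t + 1) = t * freq a b t + if a (t + 1) = b then 1 else 0 := by
  have h := mul_freq a b (t + 1)
  rw [Finset.sum_Icc_succ_top (by omega), ← mul_freq] at h
  exact_mod_cast h

lemma freq_nonneg (a : ℕ → A) (b : A) (t : ℕ) : 0 ≤ freq a b t := by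
  unfold freq
  split_ifs
  · exact le_rfl
  · exact div_nonneg (Finset.sum_nonneg fun s _ => by split_ifs <;> norm_num) (by positivity)

lemma freq_le_one (a : ℕ → A) (b : A) (t : ℕ) : freq a b t ≤ 1 := by
  induction t with
  | zero => simp [freq_zero]
  | succ t ih =>
    have h := mul_freq_succ a b t
    have ht : (0 : ℝ) ≤ t := t.cast_nonneg
    have : (if a (t + 1) = b then (1 : ℝ) else 0) ≤ 1 := by split_ifs <;> norm_num
    have : ((t : ℝ) + 1) * freq a b (t + 1) ≤ (t + 1) * 1 := by nlinarith
    exact le_of_mul_le_mul_left this (by positivity)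

lemma avgU_nonneg (u : A → ℝ) (hu : ∀ x, 0 ≤ u x) {γ : ℝ} (hγ : 0 < γ ∧ γ ≤ 1) (a : ℕ → A)
    (T : ℕ) : 0 ≤ avgU u γ a T := by
  refine div_nonneg (Finset.sum_nonneg fun t _ => mul_nonneg ?_ (hu _)) T.cast_nonneg
  nlinarith [freq_nonneg a (a t) (t - 1), freq_le_one a (a t) (t - 1)]

variable [Fintype A]

lemma mul_sum_freq (a : ℕ → A) (t : ℕ) : (t : ℝ) * ∑ b, freq a b t = t := by
  simp_rw [Finset.mul_sum, mul_freq]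
  rw [Finset.sum_comm]
  simp

lemma freq_mem_stdSimplex (a : ℕ → A) {t : ℕ} (ht : t ≠ 0) :
    (fun b => freq a b t) ∈ stdSimplex ℝ A :=
  ⟨fun b => freq_nonneg a b t,
    mul_left_cancel₀ (Nat.cast_ne_zero.2 ht) (by rw [mul_sum_freq, mul_one])⟩

/-- The `u`-weighted sum of squared frequencies. -/
noncomputable def weightedSq (u : A → ℝ) (a : ℕ → A) (t : ℕ) : ℝ :=
  ∑ b, u b * freq a b t ^ 2

lemma weightedSq_le (u : A → ℝ) (hu : ∀ x, 0 ≤ u x) (a : ℕ → A) (t : ℕ) :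
    weightedSq u a t ≤ ∑ b, u b :=
  Finset.sum_le_sum fun b _ => mul_le_of_le_one_right (hu b)
    (pow_le_one₀ (freq_nonneg a b t) (freq_le_one a b t))

/-- The discrete-time correction to the potential increment. -/
noncomputable def stepError (u : A → ℝ) (γ : ℝ) (a : ℕ → A) (t : ℕ) : ℝ :=
  ∑ b, u b * (γ / 2 * (((if a (t + 1) = b then 1 else 0) - freq a b t) ^ 2 / (t + 1)))

lemma payoff_eq_potential_increment (u : A → ℝ) (γ : ℝ) (a : ℕ → A) (t : ℕ) :
    (1 - γ * freq a (a (t + 1)) t) * u (a (t + 1)) =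
      (((t : ℝ) + 1) * ∑ b, u b * (freq a b (t + 1) - γ / 2 * freq a b (t + 1) ^ 2)
        - t * ∑ b, u b * (freq a b t - γ / 2 * freq a b t ^ 2))
      - γ / 2 * weightedSq u a t + stepError u γ a t := by
  have hsum : (1 - γ * freq a (a (t + 1)) t) * u (a (t + 1)) =
      ∑ b, u b * ((if a (t + 1) = b then 1 else 0) * (1 - γ * freq a b t)) := by
    simp [mul_comm]
  rw [hsum, weightedSq, stepError, Finset.mul_sum, Finset.mul_sum, Finset.mul_sum,
    ← Finset.sum_sub_distrib, ← Finset.sum_sub_distrib, ← Finset.sum_add_distrib]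
  refine Finset.sum_congr rfl fun b _ => ?_
  have ht : (t : ℝ) + 1 ≠ 0 := by positivity
  have h : freq a b (t + 1) = (t * freq a b t + if a (t + 1) = b then 1 else 0) / (t + 1) := by
    rw [← mul_freq_succ]; field_simp
  rw [h]
  split_ifs <;> field_simp <;> ring

lemma sum_payoff_eq (u : A → ℝ) (γ : ℝ) (a : ℕ → A) (T : ℕ) :
    ∑ t ∈ Finset.Icc 1 T, (1 - γ * freq a (a t) (t - 1)) * u (a t) =
      T * ∑ b, u b * (freq a b T - γ / 2 * freq a b T ^ 2)
      - γ / 2 * ∑ t ∈ range T, weightedSq u a t + ∑ t ∈ range T, stepError u γ a t := by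
  induction T with
  | zero => simp
  | succ T ih =>
    rw [Finset.sum_Icc_succ_top (by omega), ih, Nat.add_sub_cancel,
      payoff_eq_potential_increment, Finset.sum_range_succ, Finset.sum_range_succ]
    push_cast
    ring

/-- The average payoff is the stationary value of the current frequencies, plus a term comparing
the weighted square to its running average, plus a vanishing error. -/
lemma avgU_eq (u : A → ℝ) (γ : ℝ) (a : ℕ → A) {T : ℕ} (hT : T ≠ 0) :
    avgU u γ a T =
      ∑ b, freq a b T * (1 - γ * freq a b T) * u b
      + γ / 2 * (weightedSq u a T - (T : ℝ)⁻¹ * ∑ t ∈ range T, weightedSq u a t)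
      + (T : ℝ)⁻¹ * ∑ t ∈ range T, stepError u γ a t := by
  have hT' : (T : ℝ) ≠ 0 := Nat.cast_ne_zero.2 hT
  have h : ∑ b, u b * (freq a b T - γ / 2 * freq a b T ^ 2) =
      ∑ b, freq a b T * (1 - γ * freq a b T) * u b + γ / 2 * weightedSq u a T := by
    rw [weightedSq, Finset.mul_sum, ← Finset.sum_add_distrib]
    exact Finset.sum_congr rfl fun b _ => by ring
  rw [avgU, sum_payoff_eq, h]
  generalize ∑ b, freq a b T * (1 - γ * freq a b T) * u b = v
  field_simp
  ring

lemma tendsto_stepError (u : A → ℝ) (γ : ℝ) (a : ℕ → A) :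
    Tendsto (stepError u γ a) atTop (𝓝 0) := by
  have hterm : ∀ b, Tendsto (fun t : ℕ => u b * (γ / 2 *
      (((if a (t + 1) = b then (1 : ℝ) else 0) - freq a b t) ^ 2 / ((t : ℝ) + 1))))
      atTop (𝓝 (u b * (γ / 2 * 0))) := by
    intro b
    refine Tendsto.const_mul _ (Tendsto.const_mul _ ?_)
    refine squeeze_zero (fun t => by positivity) (fun t => ?_)
      tendsto_one_div_add_atTop_nhds_zero_nat
    have h0 := freq_nonneg a b t
    have h1 := freq_le_one a b t
    gcongr
    split_ifs <;> nlinarith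
  have h := tendsto_finsetSum Finset.univ fun b _ => hterm b
  simp only [mul_zero, Finset.sum_const_zero] at h
  exact h

end Frequencies

/-- A sequence bounded above cannot eventually exceed its running average by a fixed amount. -/
lemma not_eventually_add_average_le {g : ℕ → ℝ} {C ε : ℝ} (hε : 0 < ε) (hg : ∀ t, g t ≤ C) :
    ¬ ∀ᶠ T : ℕ in atTop, ε ≤ g T - (T : ℝ)⁻¹ * ∑ t ∈ range T, g t := by
  intro h
  obtain ⟨N, hN⟩ := eventually_atTop.1 h
  set m : ℕ → ℝ := fun T => (T : ℝ)⁻¹ * ∑ t ∈ range T, g t with hm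
  set H : ℕ → ℝ := fun T => ∑ i ∈ range T, (1 : ℝ) / ((i : ℝ) + 1) with hH
  have hstep : ∀ T, N + 1 ≤ T → m T + ε * (1 / ((T : ℝ) + 1)) ≤ m (T + 1) := by
    intro T hT
    have hT0 : (T : ℝ) ≠ 0 := Nat.cast_ne_zero.2 (by omega)
    have hT1 : (0 : ℝ) < (T : ℝ) + 1 := by positivity
    have hrec : m (T + 1) = m T + (g T - m T) * (1 / ((T : ℝ) + 1)) := by
      simp only [hm, Finset.sum_range_succ]
      push_cast
      field_simp
      ring
    rw [hrec]
    gcongr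
    exact hN T (by omega)
  have hgrow : ∀ T, N + 1 ≤ T → m (N + 1) + ε * (H T - H (N + 1)) ≤ m T := by
    intro T hT
    induction T, hT using Nat.le_induction with
    | base => simp
    | succ T hT ih =>
      have hHs : H (T + 1) = H T + 1 / ((T : ℝ) + 1) := Finset.sum_range_succ _ _
      have := hstep T hT
      rw [hHs]
      linarith
  have hbound : ∀ T, N + 1 ≤ T → m T ≤ C := by
    intro T hT
    have hT0 : (0 : ℝ) < T := Nat.cast_pos.2 (by omega)
    have : ∑ t ∈ range T, g t ≤ T * C := by
      simpa using Finset.sum_le_card_nsmul (range T) g C fun t _ => hg t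
    rw [hm]
    exact (inv_mul_le_iff₀ hT0).2 this
  have hdiv : Tendsto H atTop atTop := Real.tendsto_sum_range_one_div_nat_succ_atTop
  obtain ⟨T, hT, hlarge⟩ := ((eventually_ge_atTop (N + 1)).and
    (hdiv.eventually_gt_atTop ((C - m (N + 1)) / ε + H (N + 1)))).exists
  have h1 := hgrow T hT
  have h2 := hbound T hT
  have h3 : (C - m (N + 1)) / ε < H T - H (N + 1) := by linarith
  rw [div_lt_iff₀ hε] at h3
  linarith

section Value

variable {A : Type*} [Fintype A] [DecidableEq A]

lemma liminf_avgU_le (u : A → ℝ) (hu : ∀ x, 0 ≤ u x) {γ : ℝ} (hγ : 0 < γ ∧ γ ≤ 1) {V : ℝ}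
    (hV : ∀ x ∈ stdSimplex ℝ A, ∑ b : A, x b * (1 - γ * x b) * u b ≤ V) (a : ℕ → A) :
    liminf (fun T => avgU u γ a T) atTop ≤ V := by
  by_contra! hlt
  obtain ⟨c, hVc, hc⟩ := exists_between hlt
  have hbdd : IsBoundedUnder (· ≥ ·) atTop fun T => avgU u γ a T :=
    isBoundedUnder_of ⟨0, avgU_nonneg u hu hγ a⟩
  have hev := eventually_lt_of_lt_liminf hc hbdd
  have herr : ∀ᶠ T : ℕ in atTop,
      (T : ℝ)⁻¹ * ∑ t ∈ range T, stepError u γ a t < (c - V) / 2 :=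
    (tendsto_stepError u γ a).cesaro.eventually_lt_const (by linarith)
  refine not_eventually_add_average_le (ε := (c - V) / γ) (div_pos (by linarith) hγ.1)
    (weightedSq_le u hu a) ?_
  filter_upwards [hev, herr, eventually_ne_atTop 0] with T h1 h2 hT
  rw [avgU_eq u γ a hT] at h1
  have h3 := hV _ (freq_mem_stdSimplex a hT)
  rw [div_le_iff₀ hγ.1]
  linarith

/-- If the frequencies converge, the average payoff converges to the stationary value. -/
lemma tendsto_avgU (u : A → ℝ) (γ : ℝ) (a : ℕ → A) (x : A → ℝ)
    (hx : ∀ b, Tendsto (freq a b) atTop (𝓝 (x b))) :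
    Tendsto (fun T => avgU u γ a T) atTop (𝓝 (∑ b, x b * (1 - γ * x b) * u b)) := by
  have hsq : Tendsto (weightedSq u a) atTop (𝓝 (∑ b, u b * x b ^ 2)) :=
    tendsto_finsetSum _ fun b _ => ((hx b).pow 2).const_mul _
  have hval : Tendsto (fun T => ∑ b, freq a b T * (1 - γ * freq a b T) * u b) atTop
      (𝓝 (∑ b, x b * (1 - γ * x b) * u b)) :=
    tendsto_finsetSum _ fun b _ =>
      ((hx b).mul (((hx b).const_mul γ).const_sub 1)).mul_const _
  have h := (hval.add ((hsq.sub hsq.cesaro).const_mul (γ / 2))).add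
    (tendsto_stepError u γ a).cesaro
  rw [sub_self, mul_zero, add_zero, add_zero] at h
  refine h.congr' ?_
  filter_upwards [eventually_ne_atTop 0] with T hT
  exact (avgU_eq u γ a hT).symm

/-- Greedy apportionment: some history never exceeds the target counts by more than one. -/
lemma exists_history_mul_freq_le {x : A → ℝ} (hx : x ∈ stdSimplex ℝ A) :
    ∃ a : ℕ → A, ∀ (t : ℕ) b, (t : ℝ) * freq a b t ≤ t * x b + 1 := by
  have : Nonempty A := by
    by_contra hA
    rw [not_nonempty_iff] at hA
    simpa using hx.2
  have hpick : ∀ (t : ℕ) (c : A → ℝ), ∃ b, ∑ b, c b = t → c b < (t + 1) * x b := by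
    intro t c
    by_cases hc : ∑ b, c b = t
    · obtain ⟨b, -, hb⟩ := Finset.exists_lt_of_sum_lt (s := Finset.univ) (f := c)
        (g := fun b => ((t : ℝ) + 1) * x b) (by rw [hc, ← Finset.mul_sum, hx.2]; linarith)
      exact ⟨b, fun _ => hb⟩
    · exact ⟨Classical.arbitrary A, fun h => absurd h hc⟩
  choose pick hpick using hpick
  let counts : ℕ → A → ℝ := fun t =>
    Nat.rec 0 (fun t c b => c b + if pick t c = b then 1 else 0) t
  have hsucc : ∀ t b, counts (t + 1) b =
      counts t b + if pick t (counts t) = b then 1 else 0 := fun _ _ => rfl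
  let a : ℕ → A := fun t => pick (t - 1) (counts (t - 1))
  have hcounts : ∀ t b, counts t b = t * freq a b t := by
    intro t b
    induction t with
    | zero => simp [counts]
    | succ t ih =>
      push_cast
      rw [mul_freq_succ, hsucc, ih]
      rfl
  refine ⟨a, fun t b => ?_⟩
  induction t with
  | zero => simp
  | succ t ih =>
    have hlt := hpick t (counts t) (by
      simp_rw [hcounts]
      rw [← Finset.mul_sum, mul_sum_freq])
    have hxb := hx.1 b
    push_cast
    rw [mul_freq_succ]
    split_ifs with hab
    · have hab' : pick t (counts t) = b := hab
      rw [hab', hcounts] at hlt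
      linarith
    · linarith

/-- Every point of the simplex is the limiting frequency vector of some history. -/
lemma exists_history_tendsto_freq {x : A → ℝ} (hx : x ∈ stdSimplex ℝ A) :
    ∃ a : ℕ → A, ∀ b, Tendsto (freq a b) atTop (𝓝 (x b)) := by
  obtain ⟨a, ha⟩ := exists_history_mul_freq_le hx
  have hupper : ∀ {t : ℕ}, t ≠ 0 → ∀ b, freq a b t ≤ x b + (t : ℝ)⁻¹ := by
    intro t ht b
    have ht' : (0 : ℝ) < t := Nat.cast_pos.2 (Nat.pos_of_ne_zero ht)
    refine le_of_mul_le_mul_left ?_ ht'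
    rw [mul_add, mul_inv_cancel₀ ht'.ne']
    exact ha t b
  have hlower : ∀ {t : ℕ}, t ≠ 0 → ∀ b,
      x b - Fintype.card A * (t : ℝ)⁻¹ ≤ freq a b t := by
    intro t ht b
    have hsingle := Finset.single_le_sum (s := Finset.univ)
      (f := fun b => x b + (t : ℝ)⁻¹ - freq a b t)
      (fun b _ => sub_nonneg.2 (hupper ht b)) (Finset.mem_univ b)
    simp only [Finset.sum_sub_distrib, Finset.sum_add_distrib, hx.2,
      (freq_mem_stdSimplex a ht).2, Finset.sum_const, Finset.card_univ, nsmul_eq_mul] at hsingle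
    have : (0 : ℝ) ≤ (t : ℝ)⁻¹ := by positivity
    linarith
  refine ⟨a, fun b => ?_⟩
  have hinv : Tendsto (fun t : ℕ => (t : ℝ)⁻¹) atTop (𝓝 0) := tendsto_inv_atTop_nhds_zero_nat
  have hl : Tendsto (fun t : ℕ => x b - Fintype.card A * (t : ℝ)⁻¹) atTop (𝓝 (x b)) := by
    simpa using (hinv.const_mul (Fintype.card A : ℝ)).const_sub (x b)
  have hr : Tendsto (fun t : ℕ => x b + (t : ℝ)⁻¹) atTop (𝓝 (x b)) := by
    simpa using hinv.const_add (x b)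
  refine tendsto_of_tendsto_of_tendsto_of_le_of_le' hl hr ?_ ?_
  · filter_upwards [eventually_ne_atTop 0] with t ht using hlower ht b
  · filter_upwards [eventually_ne_atTop 0] with t ht using hupper ht b

end Value

theorem stmt11 {A : Type*} [Fintype A] [DecidableEq A] [Nonempty A]
    (u : A → ℝ) (hu : ∀ x, 0 ≤ u x) (γ : ℝ) (hγ : 0 < γ ∧ γ ≤ 1)
    (Vstar : ℝ)
    (hV : IsGreatest ((fun x : A → ℝ => ∑ b : A, x b * (1 - γ * x b) * u b) ''
      stdSimplex ℝ A) Vstar) :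
    (⨆ a : ℕ → A, liminf (fun T => avgU u γ a T) atTop) = Vstar ∧
    ∀ a : ℕ → A, liminf (fun T => avgU u γ a T) atTop ≤ Vstar := by
  have hle : ∀ a : ℕ → A, liminf (fun T => avgU u γ a T) atTop ≤ Vstar :=
    liminf_avgU_le u hu hγ fun x hx => hV.2 ⟨x, hx, rfl⟩
  refine ⟨le_antisymm (ciSup_le hle) ?_, hle⟩
  obtain ⟨x, hx, hxV⟩ := hV.1
  obtain ⟨a, ha⟩ := exists_history_tendsto_freq hx
  have hlim : liminf (fun T => avgU u γ a T) atTop = Vstar := by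
    rw [← hxV]
    exact (tendsto_avgU u γ a x ha).liminf_eq
  rw [← hlim]
  exact le_ciSup (f := fun a : ℕ → A => liminf (fun T => avgU u γ a T) atTop)
    ⟨Vstar, Set.forall_mem_range.2 hle⟩ a
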